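/- arXiv:0801.2129 — 4 statements merged into one kernel-verified Lean document; each statement's English description precedes it below -/
import Mathlib

section
/- Let α ∈ ℝ and let ω₂(ξ,μ) = −ξ⁵ − αξ³ + μ²/ξ for ξ ≠ 0 (the dispersion relation of the fifth order KP-II equation). Let ξ₁, ξ₂, μ₁, μ₂ be real numbers with ξ₁ ≠ 0, ξ₂ ≠ 0, ξ₁+ξ₂ ≠ 0, and set M = max{|ξ₁|, |ξ₂|, |ξ₁+ξ₂|} and m = min{|ξ₁|, |ξ₂|, |ξ₁+ξ₂|}. If 24|α| ≤ M², then |ω₂(ξ₁+ξ₂, μ₁+μ₂) − ω₂(ξ₁,μ₁) − ω₂(ξ₂,μ₂)| ≥ m·M⁴/4. -/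
/-- The dispersion relation of the fifth order KP-II equation. -/
noncomputable def ω₂ (α ξ μ : ℝ) : ℝ := -ξ ^ 5 - α * ξ ^ 3 + μ ^ 2 / ξ

/-- The resonance function of the fifth order KP-II equation in factored form. -/
lemma resonance_eq (α a b μ ν : ℝ) (ha : a ≠ 0) (hb : b ≠ 0) (hab : a + b ≠ 0) :
    ω₂ α (a + b) (μ + ν) - ω₂ α a μ - ω₂ α b ν =
      -(a * b * (a + b) * (5 * (a ^ 2 + a * b + b ^ 2) + 3 * α +
        ((b * μ - a * ν) / (a * b * (a + b))) ^ 2)) := by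
  unfold ω₂
  field_simp
  ring

/-- The two longest sides of a triangle have comparable lengths. -/
lemma min_mul_max_sq_le {x y z : ℝ} (hx : 0 ≤ x) (hy : 0 ≤ y) (hz : 0 ≤ z)
    (hxyz : x ≤ y + z) (hyxz : y ≤ x + z) (hzxy : z ≤ x + y) :
    min (min x y) z * max (max x y) z ^ 2 ≤ 2 * (x * y * z) := by
  have key : ∀ p q r : ℝ, 0 ≤ p → p ≤ q → q ≤ r → r ≤ p + q →
      p * r ^ 2 ≤ 2 * (p * q * r) := by
    intro p q r hp hpq hqr hr
    nlinarith [mul_nonneg (mul_nonneg hp (hp.trans (hpq.trans hqr)))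
      (by linarith : 0 ≤ 2 * q - r)]
  rcases le_total x y with h | h <;> rcases le_total y z with h' | h' <;>
    rcases le_total x z with h'' | h'' <;>
    simp only [min_eq_left, min_eq_right, max_eq_left, max_eq_right, h, h', h''] <;>
    first
    | linarith [key x y z hx (by linarith) (by linarith) (by linarith)]
    | linarith [key x z y hx (by linarith) (by linarith) (by linarith)]
    | linarith [key y x z hy (by linarith) (by linarith) (by linarith)]
    | linarith [key y z x hy (by linarith) (by linarith) (by linarith)]
    | linarith [key z x y hz (by linarith) (by linarith) (by linarith)]
    | linarith [key z y x hz (by linarith) (by linarith) (by linarith)]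
    | obtain rfl : x = y := by linarith
      obtain rfl : x = z := by linarith
      linarith [key x x x hx le_rfl le_rfl hxyz]

lemma max_abs_sq_le (a b : ℝ) :
    3 * max (max |a| |b|) |a + b| ^ 2 ≤ 4 * (a ^ 2 + a * b + b ^ 2) := by
  rcases max_choice (max |a| |b|) |a + b| with h | h
  · rw [h]
    rcases max_choice |a| |b| with h' | h' <;> rw [h', sq_abs]
    · nlinarith [sq_nonneg (a + 2 * b)]
    · nlinarith [sq_nonneg (2 * a + b)]
  · rw [h, sq_abs]
    nlinarith [sq_nonneg (a - b)]

theorem stmt4 (α ξ₁ ξ₂ μ₁ μ₂ : ℝ) (h₁ : ξ₁ ≠ 0) (h₂ : ξ₂ ≠ 0) (h₃ : ξ₁ + ξ₂ ≠ 0)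
    (hα : 24 * |α| ≤ (max (max |ξ₁| |ξ₂|) |ξ₁ + ξ₂|) ^ 2) :
    min (min |ξ₁| |ξ₂|) |ξ₁ + ξ₂| * (max (max |ξ₁| |ξ₂|) |ξ₁ + ξ₂|) ^ 4 / 4 ≤
      |ω₂ α (ξ₁ + ξ₂) (μ₁ + μ₂) - ω₂ α ξ₁ μ₁ - ω₂ α ξ₂ μ₂| := by
  have hprod := min_mul_max_sq_le (abs_nonneg ξ₁) (abs_nonneg ξ₂) (abs_nonneg (ξ₁ + ξ₂))
    (by simpa [add_comm] using abs_sub (ξ₁ + ξ₂) ξ₂)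
    (by simpa [add_comm] using abs_sub (ξ₁ + ξ₂) ξ₁) (abs_add_le ξ₁ ξ₂)
  have hmax := max_abs_sq_le ξ₁ ξ₂
  rw [resonance_eq α ξ₁ ξ₂ μ₁ μ₂ h₁ h₂ h₃, abs_neg, abs_mul, abs_mul, abs_mul]
  set M := max (max |ξ₁| |ξ₂|) |ξ₁ + ξ₂|
  set m := min (min |ξ₁| |ξ₂|) |ξ₁ + ξ₂|
  set P := |ξ₁| * |ξ₂| * |ξ₁ + ξ₂|
  set B := 5 * (ξ₁ ^ 2 + ξ₁ * ξ₂ + ξ₂ ^ 2) + 3 * α +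
    ((ξ₂ * μ₁ - ξ₁ * μ₂) / (ξ₁ * ξ₂ * (ξ₁ + ξ₂))) ^ 2 with hB
  have hbracket : M ^ 2 ≤ |B| := by
    refine le_trans ?_ (le_abs_self B)
    have := sq_nonneg ((ξ₂ * μ₁ - ξ₁ * μ₂) / (ξ₁ * ξ₂ * (ξ₁ + ξ₂)))
    linarith [neg_abs_le α, sq_nonneg M]
  have hP : 0 ≤ P := by positivity
  calc m * M ^ 4 / 4 = m * M ^ 2 * M ^ 2 / 4 := by ring
    _ ≤ 2 * P * M ^ 2 / 4 := by gcongr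
    _ ≤ P * M ^ 2 := by nlinarith [mul_nonneg hP (sq_nonneg M)]
    _ ≤ P * |B| := by gcongr
end

section
/- Let α ∈ ℝ and let ξ, μ be real numbers with |ξ| ≥ 1 and ξ² > |α|. Then the gradient of the KP-I dispersion relation satisfies ( (5ξ⁴ + 3αξ² − μ²/ξ²)² + (2μ/ξ)² )^{1/2} ≥ ξ². -/
theorem stmt5 (α ξ μ : ℝ) (hξ : 1 ≤ |ξ|) (hα : |α| < ξ ^ 2) :
    ξ ^ 2 ≤
      Real.sqrt ((5 * ξ ^ 4 + 3 * α * ξ ^ 2 - μ ^ 2 / ξ ^ 2) ^ 2 + (2 * μ / ξ) ^ 2) := by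
  apply Real.le_sqrt_of_sq_le
  have hx : 1 ≤ ξ ^ 2 := by
    rw [← sq_abs]
    exact one_le_pow₀ hξ
  have h4 : ξ ^ 4 = (ξ ^ 2) ^ 2 := by ring
  have hm : (2 * μ / ξ) ^ 2 = 4 * (μ ^ 2 / ξ ^ 2) := by ring
  have hm0 : 0 ≤ μ ^ 2 / ξ ^ 2 := by positivity
  rw [hm, h4]
  generalize μ ^ 2 / ξ ^ 2 = m at hm0 ⊢
  generalize ξ ^ 2 = x at hx hα ⊢
  have hα' : -x < α := (abs_lt.mp hα).1
  rcases le_total (x ^ 2 / 4) m with h | h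
  · nlinarith [sq_nonneg (5 * x ^ 2 + 3 * α * x - m)]
  · have hA : 2 * x ^ 2 ≤ 5 * x ^ 2 + 3 * α * x := by nlinarith
    have hle : x ≤ 5 * x ^ 2 + 3 * α * x - m := by nlinarith
    have hsq : x ^ 2 ≤ (5 * x ^ 2 + 3 * α * x - m) ^ 2 := pow_le_pow_left₀ (by linarith) hle 2
    linarith
end

section
/- Let α, ξ₁, ξ₂, μ₁, μ₂ be real numbers with ξ₁ ≠ 0, ξ₂ ≠ 0, ξ₁+ξ₂ ≠ 0 and 4|α| ≤ ξ₁². If (μ₁/ξ₁ − μ₂/ξ₂)² > (1/2) (ξ₁+ξ₂)² |5(ξ₁² + ξ₁ξ₂ + ξ₂²) − 3α|, then (2|ξ₁| / |ξ₁+ξ₂|) · |μ₁/ξ₁ − μ₂/ξ₂| > ξ₁². (Equivalently, the function f(μ) = θ₁ + θ₂ − (ξ₁ξ₂/(ξ₁+ξ₂))[ (ξ₁+ξ₂)²(5(ξ₁²+ξ₁ξ₂+ξ₂²) − 3α) − (μ₁/ξ₁ − μ/ξ₂)² ], whose derivative at μ₂ has absolute value (2|ξ₁|/|ξ₁+ξ₂|)|μ₁/ξ₁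 − μ₂/ξ₂|, satisfies |f'(μ₂)| > ξ₁².) -/
theorem stmt10 (α ξ₁ ξ₂ μ₁ μ₂ : ℝ) (h₁ : ξ₁ ≠ 0) (h₂ : ξ₂ ≠ 0) (h₃ : ξ₁ + ξ₂ ≠ 0)
    (hα : 4 * |α| ≤ ξ₁ ^ 2)
    (h : 1 / 2 * (ξ₁ + ξ₂) ^ 2 * |5 * (ξ₁ ^ 2 + ξ₁ * ξ₂ + ξ₂ ^ 2) - 3 * α| <
      (μ₁ / ξ₁ - μ₂ / ξ₂) ^ 2) :
    ξ₁ ^ 2 < 2 * |ξ₁| / |ξ₁ + ξ₂| * |μ₁ / ξ₁ - μ₂ / ξ₂| := by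
  have hS : 0 < |ξ₁ + ξ₂| := abs_pos.mpr h₃
  have hξ : 0 < |ξ₁| := abs_pos.mpr h₁
  have hQ : 3 * ξ₁ ^ 2 ≤ |5 * (ξ₁ ^ 2 + ξ₁ * ξ₂ + ξ₂ ^ 2) - 3 * α| := by
    refine le_trans ?_ (le_abs_self _)
    nlinarith [sq_nonneg (ξ₁ + 2 * ξ₂), le_abs_self α]
  have hsq : ((ξ₁ + ξ₂) * ξ₁) ^ 2 < (μ₁ / ξ₁ - μ₂ / ξ₂) ^ 2 := by
    nlinarith [mul_le_mul_of_nonneg_left hQ (sq_nonneg (ξ₁ + ξ₂)),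
      sq_nonneg ((ξ₁ + ξ₂) * ξ₁)]
  have hD : |ξ₁ + ξ₂| * |ξ₁| < |μ₁ / ξ₁ - μ₂ / ξ₂| := by
    simpa only [abs_mul] using sq_lt_sq.mp hsq
  rw [div_mul_eq_mul_div, lt_div_iff₀ hS, ← sq_abs ξ₁]
  nlinarith [mul_lt_mul_of_pos_left hD hξ, mul_pos hξ (mul_pos hS hξ)]
end

section
/- Let α ∈ ℝ, set C₀ = max(15, |α|), and let ε ∈ (0, 1/2). There exists a constant C > 0, depending only on α and ε, such that for every (ξ, μ, τ) ∈ ℝ³ with 0 < |ξ| ≤ C₀ one has |ξ| · ⟨τ − ω(ξ,μ)⟩^{−(1/2 − ε)} · ( ∫_{\{ξ₁ : |ξ₁| ≤ C₀, ξ₁ ≠ 0, ξ₁ ≠ ξ\}} ∫_ℝ ∫_ℝ ⟨τ₁ − ω(ξ₁,μ₁)⟩^{−(1+ε)} ⟨(τ − τ₁) − ω(ξ − ξ₁, μ − μ₁)⟩^{−(1+ε)} dτ₁ dμ₁ dξ₁ )^{1/2} ≤ C. -/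
open MeasureTheory

/-- The Japanese bracket `⟨x⟩ = (1 + x²)^{1/2}`. -/
noncomputable def jap (x : ℝ) : ℝ := (1 + x ^ 2) ^ ((1 : ℝ) / 2)

/-- The dispersion relation of the fifth order KP-I equation. -/
noncomputable def ω (α ξ μ : ℝ) : ℝ := ξ ^ 5 - α * ξ ^ 3 + μ ^ 2 / ξ

theorem one_le_jap (x : ℝ) : 1 ≤ jap x :=
  Real.one_le_rpow (by nlinarith [sq_nonneg x]) (by norm_num)

theorem jap_pos (x : ℝ) : 0 < jap x := one_pos.trans_le (one_le_jap x)

theorem jap_le_jap {x y : ℝ} (h : |x| ≤ |y|) : jap x ≤ jap y :=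
  Real.rpow_le_rpow (by positivity) (by linarith [sq_le_sq.2 h]) (by norm_num)

theorem one_add_abs_le_four_mul_jap_half (x : ℝ) : 1 + |x| ≤ 4 * jap (x / 2) := by
  have h : jap (x / 2) ^ 2 = 1 + (x / 2) ^ 2 := by
    rw [jap, ← Real.sqrt_eq_rpow, Real.sq_sqrt (by positivity)]
  refine abs_le_of_sq_le_sq' ?_ (by linarith [jap_pos (x / 2)]) |>.2
  nlinarith [sq_abs x, sq_nonneg (|x| - 1)]

theorem integrable_jap_rpow_neg {p : ℝ} (hp : 1 < p) :
    Integrable fun x : ℝ => jap x ^ (-p) := by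
  have h := integrable_rpow_neg_one_add_norm_sq (E := ℝ) (μ := volume) (r := p) (by simpa using hp)
  refine h.congr (Filter.Eventually.of_forall fun x => ?_)
  simp only [jap]
  rw [← Real.rpow_mul (by positivity), Real.norm_eq_abs, sq_abs]
  congr 1
  ring

theorem jap_rpow_neg_mul_le {p : ℝ} (hp : 0 ≤ p) (s t : ℝ) :
    jap s ^ (-p) * jap t ^ (-p) ≤ jap ((s + t) / 2) ^ (-p) * (jap s ^ (-p) + jap t ^ (-p)) := by
  have hs : 0 ≤ jap s ^ (-p) := Real.rpow_nonneg (jap_pos s).le _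
  have ht : 0 ≤ jap t ^ (-p) := Real.rpow_nonneg (jap_pos t).le _
  have key : ∀ u : ℝ, |(s + t) / 2| ≤ |u| → jap u ^ (-p) ≤ jap ((s + t) / 2) ^ (-p) := fun u hu =>
    Real.rpow_le_rpow_of_nonpos (jap_pos _) (jap_le_jap hu) (by linarith)
  have habs : |(s + t) / 2| ≤ (|s| + |t|) / 2 := by
    rw [abs_div, abs_two]
    linarith [abs_add_le s t]
  rcases le_total |s| |t| with h | h
  · have := key t (by linarith)
    nlinarith
  · have := key s (by linarith)
    nlinarith

theorem integral_jap_rpow_neg_mul_le {p : ℝ} (hp : 1 < p) (a b : ℝ) :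
    ∫ t : ℝ, jap (t - a) ^ (-p) * jap (b - t) ^ (-p) ≤
      8 * (∫ t : ℝ, jap t ^ (-p)) * (1 + |b - a|)⁻¹ := by
  have hi := integrable_jap_rpow_neg hp
  have h1 : Integrable fun t : ℝ => jap (t - a) ^ (-p) := hi.comp_sub_right a
  have h2 : Integrable fun t : ℝ => jap (b - t) ^ (-p) := hi.comp_sub_left b
  have e1 : ∫ t : ℝ, jap (t - a) ^ (-p) = ∫ t : ℝ, jap t ^ (-p) :=
    integral_sub_right_eq_self (fun t => jap t ^ (-p)) a
  have e2 : ∫ t : ℝ, jap (b - t) ^ (-p) = ∫ t : ℝ, jap t ^ (-p) :=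
    integral_sub_left_eq_self (fun t => jap t ^ (-p)) volume b
  have hJ : 0 ≤ ∫ t : ℝ, jap t ^ (-p) := integral_nonneg fun t => Real.rpow_nonneg (jap_pos t).le _
  have hw : jap ((b - a) / 2) ^ (-p) ≤ 4 * (1 + |b - a|)⁻¹ := by
    calc jap ((b - a) / 2) ^ (-p) ≤ jap ((b - a) / 2) ^ (-1 : ℝ) :=
          Real.rpow_le_rpow_of_exponent_le (one_le_jap _) (by linarith)
      _ = (jap ((b - a) / 2))⁻¹ := Real.rpow_neg_one _
      _ ≤ 4 * (1 + |b - a|)⁻¹ := by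
          rw [← div_eq_mul_inv, inv_le_comm₀ (jap_pos _) (by positivity), inv_div,
            div_le_iff₀ (by norm_num)]
          linarith [one_add_abs_le_four_mul_jap_half (b - a)]
  calc ∫ t : ℝ, jap (t - a) ^ (-p) * jap (b - t) ^ (-p)
      ≤ ∫ t : ℝ, jap ((b - a) / 2) ^ (-p) * (jap (t - a) ^ (-p) + jap (b - t) ^ (-p)) := by
        refine integral_mono_of_nonneg (Filter.Eventually.of_forall fun t => ?_)
          ((h1.add h2).const_mul _) (Filter.Eventually.of_forall fun t => ?_)
        · exact mul_nonneg (Real.rpow_nonneg (jap_pos _).le _) (Real.rpow_nonneg (jap_pos _).le _)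
        · have := jap_rpow_neg_mul_le (by linarith : 0 ≤ p) (t - a) (b - t)
          rwa [show t - a + (b - t) = b - a by ring] at this
    _ = jap ((b - a) / 2) ^ (-p) * (2 * ∫ t : ℝ, jap t ^ (-p)) := by
        rw [integral_const_mul, integral_add h1 h2, e1, e2, two_mul]
    _ ≤ 4 * (1 + |b - a|)⁻¹ * (2 * ∫ t : ℝ, jap t ^ (-p)) := by gcongr
    _ = _ := by ring

theorem sq_abs_sub_sqrt_le (A y : ℝ) : (|y| - √A) ^ 2 ≤ |A - y ^ 2| := by
  rcases le_total A 0 with h | h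
  · rw [Real.sqrt_eq_zero_of_nonpos h, sub_zero, sq_abs, abs_sub_comm]
    exact le_trans (by linarith) (le_abs_self _)
  · have ha := Real.sqrt_nonneg A
    have e : A - y ^ 2 = (√A - |y|) * (√A + |y|) := by
      linear_combination -Real.sq_sqrt h + sq_abs y
    rw [e, abs_mul, abs_of_nonneg (by positivity : 0 ≤ √A + |y|), abs_sub_comm, ← sq_abs, sq]
    gcongr
    exact (abs_sub _ _).trans (by rw [abs_abs, abs_of_nonneg ha, add_comm])

theorem inv_one_add_abs_sub_sq_le (A y : ℝ) :
    (1 + |A - y ^ 2|)⁻¹ ≤ (1 + (y - √A) ^ 2)⁻¹ + (1 + (y + √A) ^ 2)⁻¹ := by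
  have h : (1 + |A - y ^ 2|)⁻¹ ≤ (1 + (|y| - √A) ^ 2)⁻¹ := by
    gcongr
    exact sq_abs_sub_sqrt_le A y
  have h1 : 0 ≤ (1 + (y - √A) ^ 2)⁻¹ := by positivity
  have h2 : 0 ≤ (1 + (y + √A) ^ 2)⁻¹ := by positivity
  rcases abs_cases y with ⟨e, -⟩ | ⟨e, -⟩ <;> rw [e] at h
  · linarith
  · rw [show (-y - √A) ^ 2 = (y + √A) ^ 2 by ring] at h
    linarith

theorem integrable_inv_one_add_sq_affine {c : ℝ} (hc : 0 < c) (m a : ℝ) :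
    Integrable fun x : ℝ => (1 + (c * (x - m) + a) ^ 2)⁻¹ :=
  ((integrable_inv_one_add_sq.comp_add_right a).comp_mul_left' hc.ne').comp_sub_right m

theorem integral_inv_one_add_sq_affine {c : ℝ} (hc : 0 < c) (m a : ℝ) :
    ∫ x : ℝ, (1 + (c * (x - m) + a) ^ 2)⁻¹ = Real.pi / c := by
  rw [integral_sub_right_eq_self (fun x => (1 + (c * x + a) ^ 2)⁻¹) m,
    Measure.integral_comp_mul_left (fun x => (1 + (x + a) ^ 2)⁻¹) c,
    integral_add_right_eq_self (fun x => (1 + x ^ 2)⁻¹) a, integral_univ_inv_one_add_sq,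
    abs_of_pos (inv_pos.2 hc), smul_eq_mul]
  ring

theorem inv_one_add_abs_sub_mul_sq_le {κ : ℝ} (hκ : κ ≠ 0) (A : ℝ) :
    ∃ a : ℝ, ∀ y : ℝ, (1 + |A - κ * y ^ 2|)⁻¹ ≤
      (1 + (√|κ| * y + -a) ^ 2)⁻¹ + (1 + (√|κ| * y + a) ^ 2)⁻¹ := by
  have hsq := Real.sq_sqrt (abs_nonneg κ)
  rcases lt_or_gt_of_ne hκ with h | h
  · refine ⟨√(-A), fun y => ?_⟩
    rw [← sub_eq_add_neg]
    convert inv_one_add_abs_sub_sq_le (-A) (√|κ| * y) using 3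
    rw [mul_pow, hsq, abs_of_neg h, ← abs_neg]
    ring_nf
  · refine ⟨√A, fun y => ?_⟩
    rw [← sub_eq_add_neg]
    convert inv_one_add_abs_sub_sq_le A (√|κ| * y) using 3
    rw [mul_pow, hsq, abs_of_pos h]

theorem integral_le_of_le_inv_one_add_abs_sub_mul_sq {f : ℝ → ℝ} {κ K : ℝ} (hκ : κ ≠ 0)
    (hK : 0 ≤ K) (A m : ℝ) (hf : ∀ x, 0 ≤ f x)
    (hfK : ∀ x, f x ≤ K * (1 + |A - κ * (x - m) ^ 2|)⁻¹) :
    ∫ x, f x ≤ K * (2 * Real.pi / √|κ|) := by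
  obtain ⟨a, ha⟩ := inv_one_add_abs_sub_mul_sq_le hκ A
  have hc : 0 < √|κ| := Real.sqrt_pos.2 (abs_pos.2 hκ)
  have h1 := integrable_inv_one_add_sq_affine hc m (-a)
  have h2 := integrable_inv_one_add_sq_affine hc m a
  calc ∫ x, f x ≤ ∫ x, K * ((1 + (√|κ| * (x - m) + -a) ^ 2)⁻¹
        + (1 + (√|κ| * (x - m) + a) ^ 2)⁻¹) :=
        integral_mono_of_nonneg (Filter.Eventually.of_forall hf) ((h1.add h2).const_mul K)
          (Filter.Eventually.of_forall fun x =>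
            (hfK x).trans (mul_le_mul_of_nonneg_left (ha _) hK))
    _ = K * (2 * Real.pi / √|κ|) := by
        rw [integral_const_mul, integral_add h1 h2, integral_inv_one_add_sq_affine hc,
          integral_inv_one_add_sq_affine hc]
        ring

/-- Completing the square in the resonance function. -/
theorem sub_ω_sub_ω (α τ μ μ₁ : ℝ) {ξ ξ₁ : ℝ} (h : ξ ≠ 0) (h₁ : ξ₁ ≠ 0) (h₂ : ξ - ξ₁ ≠ 0) :
    τ - ω α (ξ - ξ₁) (μ - μ₁) - ω α ξ₁ μ₁ =
      (τ - ω α ξ₁ 0 - ω α (ξ - ξ₁) 0 - μ ^ 2 / ξ) -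
        ξ / (ξ₁ * (ξ - ξ₁)) * (μ₁ - μ * ξ₁ / ξ) ^ 2 := by
  simp only [ω]
  field_simp
  ring

theorem inv_sqrt_abs_div_le {ξ ξ₁ R : ℝ} (h : 0 < |ξ|) (hR : |ξ| ≤ R) (h₁ : |ξ₁| ≤ R) :
    1 / √|ξ / (ξ₁ * (ξ - ξ₁))| ≤ 1 + 2 * R ^ 2 / |ξ| := by
  have hR0 : 0 ≤ R := h.le.trans hR
  have e : 1 / √|ξ / (ξ₁ * (ξ - ξ₁))| = √(|ξ₁| * |ξ - ξ₁| / |ξ|) := by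
    rw [one_div, ← Real.sqrt_inv, abs_div, abs_mul, inv_div]
  have hle : |ξ₁| * |ξ - ξ₁| / |ξ| ≤ 2 * R ^ 2 / |ξ| := by
    refine div_le_div_of_nonneg_right ?_ h.le
    calc |ξ₁| * |ξ - ξ₁| ≤ R * (R + R) :=
          mul_le_mul h₁ ((abs_sub _ _).trans (add_le_add hR h₁)) (abs_nonneg _) hR0
      _ = 2 * R ^ 2 := by ring
  rw [e]
  refine (Real.sqrt_le_sqrt hle).trans ((Real.sqrt_le_left (by positivity)).2 ?_)
  nlinarith [show 0 ≤ 2 * R ^ 2 / |ξ| by positivity]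

theorem stmt16 (α ε : ℝ) (hε₁ : 0 < ε) (hε₂ : ε < 1 / 2) :
    ∃ C : ℝ, 0 < C ∧ ∀ ξ μ τ : ℝ, 0 < |ξ| → |ξ| ≤ max 15 |α| →
      |ξ| * jap (τ - ω α ξ μ) ^ (-(1 / 2 - ε)) *
        (∫ ξ₁ in {x : ℝ | |x| ≤ max 15 |α| ∧ x ≠ 0 ∧ x ≠ ξ},
          ∫ μ₁ : ℝ, ∫ τ₁ : ℝ,
            jap (τ₁ - ω α ξ₁ μ₁) ^ (-(1 + ε)) *
              jap ((τ - τ₁) - ω α (ξ - ξ₁) (μ - μ₁)) ^ (-(1 + ε))) ^ ((1 : ℝ) / 2) ≤ C := by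
  set R : ℝ := max 15 |α|
  have hR : 0 < R := lt_of_lt_of_le (by norm_num) (le_max_left _ _)
  set K : ℝ := 8 * ∫ t : ℝ, jap t ^ (-(1 + ε))
  have hK : 0 ≤ K := mul_nonneg (by norm_num)
    (integral_nonneg fun t => Real.rpow_nonneg (jap_pos t).le _)
  have hpi := Real.pi_pos
  refine ⟨√(K * (2 * Real.pi) * (2 * R) * (R ^ 2 + 2 * R ^ 2 * R)) + 1, by positivity,
    fun ξ μ τ h hξR => ?_⟩
  set F : ℝ → ℝ → ℝ := fun ξ₁ μ₁ => ∫ τ₁ : ℝ,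
    jap (τ₁ - ω α ξ₁ μ₁) ^ (-(1 + ε)) * jap ((τ - τ₁) - ω α (ξ - ξ₁) (μ - μ₁)) ^ (-(1 + ε))
  have hF : ∀ ξ₁ μ₁, 0 ≤ F ξ₁ μ₁ := fun ξ₁ μ₁ => integral_nonneg fun t =>
    mul_nonneg (Real.rpow_nonneg (jap_pos _).le _) (Real.rpow_nonneg (jap_pos _).le _)
  set S : Set ℝ := {x : ℝ | |x| ≤ R ∧ x ≠ 0 ∧ x ≠ ξ}
  have hS : S ⊆ Set.Icc (-R) R := fun x hx => abs_le.1 hx.1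
  have hSreal : volume.real S ≤ 2 * R := by
    refine (measureReal_mono hS (by simp)).trans ?_
    rw [Real.volume_real_Icc_of_le (by linarith)]
    linarith
  set M : ℝ := K * (2 * Real.pi) * (1 + 2 * R ^ 2 / |ξ|)
  have hM : 0 ≤ M := by positivity
  have hinner : ∀ ξ₁ ∈ S, ‖∫ μ₁, F ξ₁ μ₁‖ ≤ M := by
    rintro ξ₁ ⟨h₁R, h₁, h₁ξ⟩
    rw [Real.norm_of_nonneg (integral_nonneg (hF ξ₁))]
    have h0 : ξ ≠ 0 := abs_pos.1 h
    have h₂ : ξ - ξ₁ ≠ 0 := sub_ne_zero.2 h₁ξ.symm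
    refine (integral_le_of_le_inv_one_add_abs_sub_mul_sq
      (div_ne_zero h0 (mul_ne_zero h₁ h₂)) hK
      (τ - ω α ξ₁ 0 - ω α (ξ - ξ₁) 0 - μ ^ 2 / ξ) (μ * ξ₁ / ξ) (hF ξ₁) fun μ₁ => ?_).trans ?_
    · rw [← sub_ω_sub_ω α τ μ μ₁ h0 h₁ h₂]
      convert integral_jap_rpow_neg_mul_le (by linarith : 1 < 1 + ε) (ω α ξ₁ μ₁)
        (τ - ω α (ξ - ξ₁) (μ - μ₁)) using 6
      ring
    · rw [div_eq_mul_one_div, ← mul_assoc]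
      exact mul_le_mul_of_nonneg_left (inv_sqrt_abs_div_le h hξR h₁R) (by positivity)
  have hX : ∫ ξ₁ in S, ∫ μ₁, F ξ₁ μ₁ ≤ M * (2 * R) := by
    refine (le_abs_self _).trans ((norm_setIntegral_le_of_norm_le_const
      ((measure_mono hS).trans_lt (by simp)) hinner).trans ?_)
    gcongr
  have hjap : jap (τ - ω α ξ μ) ^ (-(1 / 2 - ε)) ≤ 1 :=
    Real.rpow_le_one_of_one_le_of_nonpos (one_le_jap _) (by linarith)
  rw [← Real.sqrt_eq_rpow]
  calc |ξ| * jap (τ - ω α ξ μ) ^ (-(1 / 2 - ε)) * √(∫ ξ₁ in S, ∫ μ₁, F ξ₁ μ₁)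
      ≤ |ξ| * 1 * √(M * (2 * R)) := by gcongr
    _ = √(|ξ| ^ 2 * (M * (2 * R))) := by
        rw [Real.sqrt_mul (sq_nonneg |ξ|), Real.sqrt_sq h.le, mul_one]
    _ = √(K * (2 * Real.pi) * (2 * R) * (|ξ| ^ 2 + 2 * R ^ 2 * |ξ|)) := by
        congr 1
        simp only [M]
        field_simp
    _ ≤ √(K * (2 * Real.pi) * (2 * R) * (R ^ 2 + 2 * R ^ 2 * R)) := by gcongr
    _ ≤ _ := by linarith
end
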